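/- Let m ≥ 0 and n ≥ 1 be integers, let Ω be an open subset of ℂⁿ containing (ℝ ∪ iℝ)ⁿ, and let f̃ : ℝᵐ × Ω → ℂ be such that for each fixed x ∈ ℝᵐ the map z ↦ f̃(x,z) is holomorphic on Ω. Suppose f̃(x,y) ∈ ℝ for all (x,y) ∈ ℝᵐ × ℝⁿ, and suppose that the map (x,y) ↦ f̃(x, iy) (from ℝᵐ × ℝⁿ to ℂ) is integrable with respect to the product measure γₘ ⊗ γₙ. Then the integral ∫∫ f̃(x, iy) dγₘ(x) dγₙ(y) is a real number (its imaginary part is zero). -/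

import Mathlib

open MeasureTheory ProbabilityTheory Filter

/-- The set of points of `ℂⁿ` all of whose coordinates are either real or purely
imaginary, i.e. `(ℝ ∪ iℝ)ⁿ`. -/
def realOrImag (n : ℕ) : Set (Fin n → ℂ) :=
  {z | ∀ j, (z j).im = 0 ∨ (z j).re = 0}

/-- The standard Gaussian probability measure on `ℝⁿ` (product of standard Gaussians). -/
noncomputable def stdGaussianPi (n : ℕ) : Measure (Fin n → ℝ) :=
  Measure.pi fun _ => gaussianReal 0 1

theorem isPreconnected_im_eq_zero_or_re_eq_zero : IsPreconnected {t : ℂ | t.im = 0 ∨ t.re = 0} := by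
  have hstar : StarConvex ℝ (0 : ℂ) {t : ℂ | t.im = 0 ∨ t.re = 0} := by
    rw [starConvex_zero_iff]
    rintro t (ht | ht) a - -
    · exact Or.inl (by simp [ht])
    · exact Or.inr (by simp [ht])
  exact (hstar.isPathConnected (Or.inl rfl)).isConnected.isPreconnected

/-- Two functions holomorphic near the coordinate axes of `ℂ` that agree on the real axis agree on
the imaginary axis too. -/
theorem eqOn_axes_of_eq_on_real {φ ψ : ℂ → ℂ} {U V : Set ℂ} (hU : IsOpen U) (hV : IsOpen V)
    (hUax : {t : ℂ | t.im = 0 ∨ t.re = 0} ⊆ U) (hVax : {t : ℂ | t.im = 0 ∨ t.re = 0} ⊆ V)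
    (hφ : DifferentiableOn ℂ φ U) (hψ : DifferentiableOn ℂ ψ V)
    (heq : ∀ r : ℝ, φ r = ψ r) :
    Set.EqOn φ ψ {t : ℂ | t.im = 0 ∨ t.re = 0} := by
  have hφa : AnalyticOnNhd ℂ φ {t : ℂ | t.im = 0 ∨ t.re = 0} :=
    fun t ht => hφ.analyticAt (hU.mem_nhds (hUax ht))
  have hψa : AnalyticOnNhd ℂ ψ {t : ℂ | t.im = 0 ∨ t.re = 0} :=
    fun t ht => hψ.analyticAt (hV.mem_nhds (hVax ht))
  have h0 : (0 : ℂ) ∈ {t : ℂ | t.im = 0 ∨ t.re = 0} := Or.inl rfl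
  refine hφa.eqOn_of_preconnected_of_frequently_eq hψa isPreconnected_im_eq_zero_or_re_eq_zero h0 ?_
  have htend : Tendsto (fun r : ℝ => (r : ℂ)) (nhdsWithin 0 {0}ᶜ) (nhdsWithin 0 {0}ᶜ) := by
    refine tendsto_nhdsWithin_iff.mpr ⟨?_, ?_⟩
    · exact (Complex.continuous_ofReal.tendsto' 0 0 Complex.ofReal_zero).mono_left
        nhdsWithin_le_nhds
    · filter_upwards [self_mem_nhdsWithin] with r hr
      simpa using hr
  exact htend.frequently (Eventually.of_forall heq).frequently

/-- Schwarz reflection on `(ℝ ∪ iℝ)ⁿ`: a holomorphic function that is real on `ℝⁿ` commutes with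
complex conjugation there. -/
theorem conj_eq_of_real_on_real {n : ℕ} {Ω : Set (Fin n → ℂ)} (hΩ : IsOpen Ω)
    (hΩR : realOrImag n ⊆ Ω) {g : (Fin n → ℂ) → ℂ} (hg : DifferentiableOn ℂ g Ω)
    (hreal : ∀ y : Fin n → ℝ, (g (fun j => (y j : ℂ))).im = 0)
    {z : Fin n → ℂ} (hz : z ∈ realOrImag n) :
    g z = star (g (star z)) := by
  suffices H : ∀ (S : Finset (Fin n)) (z : Fin n → ℂ), z ∈ realOrImag n →
      (∀ j ∉ S, (z j).im = 0) → g z = star (g (star z)) from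
    H Finset.univ z hz (by simp)
  intro S
  induction S using Finset.induction_on with
  | empty =>
    intro z _ him
    obtain ⟨y, rfl⟩ : ∃ y : Fin n → ℝ, z = fun j => (y j : ℂ) :=
      ⟨fun j => (z j).re, funext fun j => Complex.ext (by simp) (by simp [him j])⟩
    have hstar : star (fun j => (y j : ℂ)) = fun j => (y j : ℂ) :=
      funext fun j => Complex.conj_ofReal (y j)
    rw [hstar]
    exact (Complex.conj_eq_iff_im.mpr (hreal y)).symm
  | insert k S _ ih =>
    intro z hz him
    have hupd : ∀ w ∈ realOrImag n, ∀ t ∈ {t : ℂ | t.im = 0 ∨ t.re = 0},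
        Function.update w k t ∈ realOrImag n := by
      intro w hw t ht j
      rcases eq_or_ne j k with rfl | hj
      · simpa using ht
      · simpa [hj] using hw j
    have hstar : ∀ w ∈ realOrImag n, star w ∈ realOrImag n := fun w hw j => by
      simpa using hw j
    have hopen : ∀ w : Fin n → ℂ, IsOpen (Function.update w k ⁻¹' Ω) := fun w =>
      hΩ.preimage (continuous_const.update k continuous_id)
    have hdiff : ∀ w : Fin n → ℂ,
        DifferentiableOn ℂ (fun t => g (Function.update w k t)) (Function.update w k ⁻¹' Ω) :=
      fun w => hg.comp
        (fun t _ => (hasFDerivAt_update w t).differentiableAt.differentiableWithinAt)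
        (Set.mapsTo_preimage _ _)
    have hupdstar : ∀ t, Function.update (star z) k (star t) = star (Function.update z k t) := by
      intro t
      ext j
      rcases eq_or_ne j k with rfl | hj <;> simp [*]
    have key := eqOn_axes_of_eq_on_real (φ := fun t => g (Function.update z k t))
      (ψ := star ∘ (fun t => g (Function.update (star z) k t)) ∘ star)
      (hopen z) ((hopen (star z)).preimage continuous_star)
      (fun t ht => hΩR (hupd z hz t ht))
      (fun t ht => hΩR (hupd _ (hstar z hz) _ (by simpa using ht)))
      (hdiff z)
      (fun t ht => (differentiableAt_conj_conj_iff.mpr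
        ((hdiff (star z)).differentiableAt
          ((hopen (star z)).mem_nhds ht))).differentiableWithinAt)
      (fun r => by
        simp only [Function.comp_apply, hupdstar]
        refine ih _ (hupd z hz _ (Or.inl (Complex.ofReal_im r))) fun j hj => ?_
        rcases eq_or_ne j k with rfl | hjk
        · simp
        · simpa [hjk] using him j (by simp [hjk, hj]))
    have := key (hz k)
    simpa only [Function.comp_apply, hupdstar, Function.update_eq_self] using this

theorem measurePreserving_neg_stdGaussianPi (n : ℕ) :
    MeasurePreserving (fun y : Fin n → ℝ => -y) (stdGaussianPi n) (stdGaussianPi n) :=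
  measurePreserving_pi _ _ fun _ =>
    ⟨measurable_neg, gaussianReal_map_neg.trans (by rw [neg_zero])⟩

/-- if `f̃ : ℝᵐ × Ω → ℂ` is holomorphic in the last `n` variables on an open set
`Ω ⊇ (ℝ ∪ iℝ)ⁿ`, is real-valued on `ℝᵐ × ℝⁿ`, and `(x,y) ↦ f̃(x, iy)` is integrable with respect
to `γₘ ⊗ γₙ`, then `∫∫ f̃(x, iy) dγₘ(x) dγₙ(y)` is real. -/
theorem wrong_sign_expectation_real
    (m n : ℕ) (hn : 1 ≤ n)
    (Ω : Set (Fin n → ℂ)) (hΩ : IsOpen Ω) (hΩR : realOrImag n ⊆ Ω)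
    (f : (Fin m → ℝ) → (Fin n → ℂ) → ℂ)
    (hf : ∀ x : Fin m → ℝ, DifferentiableOn ℂ (f x) Ω)
    (hreal : ∀ (x : Fin m → ℝ) (y : Fin n → ℝ), (f x (fun j => (y j : ℂ))).im = 0)
    (hint : Integrable
      (fun p : (Fin m → ℝ) × (Fin n → ℝ) => f p.1 (fun j => Complex.I * (p.2 j : ℂ)))
      ((stdGaussianPi m).prod (stdGaussianPi n))) :
    (∫ p : (Fin m → ℝ) × (Fin n → ℝ),
        f p.1 (fun j => Complex.I * (p.2 j : ℂ))
        ∂((stdGaussianPi m).prod (stdGaussianPi n))).im = 0 := by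
  have : ∀ k, IsProbabilityMeasure (stdGaussianPi k) := fun k => by
    unfold stdGaussianPi; infer_instance
  have hconj : ∀ p : (Fin m → ℝ) × (Fin n → ℝ),
      f p.1 (fun j => Complex.I * ((-p.2) j : ℝ)) =
        (starRingEnd ℂ) (f p.1 (fun j => Complex.I * (p.2 j : ℂ))) := by
    intro p
    rw [conj_eq_of_real_on_real hΩ hΩR (hf p.1) (hreal p.1)
      (z := fun j => Complex.I * ((-p.2) j : ℝ)) (fun j => Or.inr (by simp))]
    congr 2
    ext j
    simp
  have hmp : MeasurePreserving
      ((MeasurableEquiv.refl (Fin m → ℝ)).prodCongr (MeasurableEquiv.neg (Fin n → ℝ)))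
      ((stdGaussianPi m).prod (stdGaussianPi n)) ((stdGaussianPi m).prod (stdGaussianPi n)) :=
    (MeasurePreserving.id _).prod (measurePreserving_neg_stdGaussianPi n)
  rw [← Complex.conj_eq_iff_im, ← integral_conj]
  simp_rw [← hconj]
  exact hmp.integral_comp' (fun p => f p.1 (fun j => Complex.I * (p.2 j : ℂ)))
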